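/- Let k ≥ 3 and 0 < γ < 1/4^{k−1}. There exist constants c > 0 and R₀ (depending only on k and γ) such that for every R ≥ R₀ and N = ⌈20(2k)^{k/2}⌉·R the following holds: every real polynomial p in the NR variables of {−1,1}^{NR} satisfying |p(x) − f(x)| < 2/3 for all x ∈ D with Hamming weight |x| ≤ N, and |p(x)| < 5/3 for all x ∈ {−1,1}^{NR} with |x| ≤ N and x ∉ D, has total degree at least c·√(N^{1−1/k})/(ln N)², where f = GapOR_R^γ ∘ THR_N^k with domain D. -/

import Mathlib

open Finset
open scoped Classical

/-- `toSign b` is the real ±1-value encoded by the Boolean `b`, with `true ↦ −1`. -/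
noncomputable def toSign (b : Bool) : ℝ := if b then -1 else 1

/-- Hamming weight: the number of coordinates equal to −1 (encoded by `true`). -/
def wt {n : ℕ} (x : Fin n → Bool) : ℕ := (Finset.univ.filter (fun i => x i = true)).card

/-- Hamming weight of an input of `{−1,1}^{NR}`, given as `R` blocks of length `N`. -/
def wt2 {N R : ℕ} (x : Fin R → Fin N → Bool) : ℕ :=
  (Finset.univ.filter (fun p : Fin R × Fin N => x p.1 p.2 = true)).card

/-- `THR_N^k(x) = −1` (i.e. `true`) iff `|x| ≥ k`. -/
def THR (N k : ℕ) (x : Fin N → Bool) : Bool := decide (k ≤ wt x)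

/-- The domain of `f = GapOR_R^γ ∘ THR_N^k`. -/
def inDom (γ : ℝ) (N R k : ℕ) (x : Fin R → Fin N → Bool) : Prop :=
  (∀ i, THR N k (x i) = false) ∨
    γ * R ≤ ((Finset.univ.filter (fun i => THR N k (x i) = true)).card : ℝ)

/-- The value of `f = GapOR_R^γ ∘ THR_N^k` on its domain. -/
noncomputable def fval (N R k : ℕ) (x : Fin R → Fin N → Bool) : ℝ :=
  if ∀ i, THR N k (x i) = false then 1 else -1

section UnivariateBounds

open Polynomial

/-- A weak form of Markov's inequality at the right end of `[-1, 1]`. -/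
lemma abs_derivative_eval_one_le {n : ℕ} {P : ℝ[X]} (hP : P.natDegree ≤ n) {B : ℝ} (hB : 0 < B)
    (hbd : ∀ x ∈ Set.Icc (-1 : ℝ) 1, |P.eval x| ≤ B) : |(derivative P).eval 1| ≤ n ^ 2 * B := by
  have key : ∀ s : ℝ, |s| = 1 / B → s * (derivative P).eval 1 ≤ (n : ℝ) ^ 2 := by
    intro s hs
    have h := Chebyshev.eval_iterate_derivative_le_of_forall_abs_le_one (n := n)
      (P := Polynomial.C s * P) (k := 1) (x := 1) le_rfl
      (degree_le_of_natDegree_le ((natDegree_C_mul_le _ _).trans hP)) (by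
        intro x hx
        rw [eval_mul, eval_C, abs_mul, hs]
        have := hbd x hx
        rw [one_div, inv_mul_le_iff₀ hB]
        linarith)
    simpa [Chebyshev.derivative_T_eval_one] using h
  have h1 := key (1 / B) (abs_of_pos (by positivity))
  have h2 := key (-(1 / B)) (by rw [abs_neg]; exact abs_of_pos (by positivity))
  rw [abs_le]
  have e : (derivative P).eval 1 = B * (1 / B * (derivative P).eval 1) := by field_simp
  constructor <;> rw [e] <;> nlinarith

/-- Markov's inequality at an end `b` of the interval between `a` and `b`. -/
lemma abs_derivative_eval_endpoint_le {n : ℕ} {P : ℝ[X]} (hP : P.natDegree ≤ n) {B : ℝ}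
    (hB : 0 < B) {a b : ℝ} (hab : a ≠ b) (hbd : ∀ x ∈ Set.uIcc a b, |P.eval x| ≤ B) :
    |(derivative P).eval b| ≤ 2 * n ^ 2 / |b - a| * B := by
  set Q : ℝ[X] := P.comp (C ((b - a) / 2) * X + C ((a + b) / 2)) with hQ
  have hQd : Q.natDegree ≤ n := by
    rw [hQ]
    refine natDegree_comp_le.trans ?_
    calc _ ≤ P.natDegree * 1 := Nat.mul_le_mul_left _ (natDegree_linear_le)
      _ ≤ n := by simpa using hP
  have h := abs_derivative_eval_one_le hQd hB (by
    intro x hx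
    rw [hQ, eval_comp]
    apply hbd
    simp only [eval_add, eval_mul, eval_C, eval_X]
    obtain ⟨h1, h2⟩ := hx
    rw [Set.mem_uIcc]
    rcases le_total a b with h | h
    · left; constructor <;> nlinarith
    · right; constructor <;> nlinarith)
  have e : (derivative Q).eval 1 = (b - a) / 2 * (derivative P).eval b := by
    rw [hQ, derivative_comp]
    simp only [eval_mul, eval_comp, derivative_add, derivative_C_mul, derivative_X,
      derivative_C, eval_add, eval_C, eval_X, mul_one, add_zero]
    congr 2
    ring
  rw [e, abs_mul, abs_div, abs_two] at h
  have hpos : 0 < |b - a| := abs_pos.2 (sub_ne_zero.2 hab.symm)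
  have e2 : 2 * (n : ℝ) ^ 2 / |b - a| * B = 2 * (n ^ 2 * B) / |b - a| := by ring
  rw [e2, le_div_iff₀ hpos]
  linarith

/-- Markov's inequality, up to a factor of two. -/
lemma abs_derivative_eval_le {n : ℕ} {P : ℝ[X]} (hP : P.natDegree ≤ n) {B : ℝ}
    (hB : 0 < B) {a b : ℝ} (hab : a < b) (hbd : ∀ x ∈ Set.Icc a b, |P.eval x| ≤ B)
    {x : ℝ} (hx : x ∈ Set.Icc a b) :
    |(derivative P).eval x| ≤ 4 * n ^ 2 / (b - a) * B := by
  obtain ⟨y, hy, hyx⟩ : ∃ y ∈ Set.Icc a b, (b - a) / 2 ≤ |x - y| := by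
    rcases le_total x ((a + b) / 2) with h | h
    · refine ⟨b, ⟨hab.le, le_rfl⟩, ?_⟩
      rw [abs_sub_comm]
      exact le_trans (by linarith) (le_abs_self _)
    · refine ⟨a, ⟨le_rfl, hab.le⟩, ?_⟩
      exact le_trans (by linarith) (le_abs_self _)
  have hpos : 0 < |x - y| := by linarith
  refine (abs_derivative_eval_endpoint_le hP hB (a := y) (b := x) ?_ ?_).trans ?_
  · rintro rfl
    simp at hpos
  · intro z hz
    exact hbd z (Set.uIcc_subset_Icc hy hx hz)
  · gcongr ?_ * B
    rw [div_le_div_iff₀ hpos (by linarith)]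
    nlinarith [sq_nonneg (n : ℝ)]

lemma abs_eval_sub_eval_le {n : ℕ} {P : ℝ[X]} (hP : P.natDegree ≤ n) {B : ℝ}
    (hB : 0 < B) {a b : ℝ} (hab : a < b) (hbd : ∀ x ∈ Set.Icc a b, |P.eval x| ≤ B)
    {x y : ℝ} (hx : x ∈ Set.Icc a b) (hy : y ∈ Set.Icc a b) :
    |P.eval y - P.eval x| ≤ 4 * n ^ 2 / (b - a) * B * |y - x| := by
  have := Convex.norm_image_sub_le_of_norm_hasDerivWithin_le (f := fun z => P.eval z)
    (f' := fun z => (derivative P).eval z) (s := Set.Icc a b)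
    (C := 4 * n ^ 2 / (b - a) * B)
    (fun z _ => (P.hasDerivAt z).hasDerivWithinAt)
    (fun z hz => abs_derivative_eval_le hP hB hab hbd hz) (convex_Icc a b) hx hy
  simpa using this

/-- A low-degree polynomial bounded at the integers of `[0, M]` is bounded on all of `[0, M]`. -/
lemma abs_eval_le_of_abs_eval_natCast_le {n M : ℕ} {P : ℝ[X]} (hP : P.natDegree ≤ n) {B : ℝ}
    (hB : 0 < B) (hM : 0 < M) (hn : 4 * n ^ 2 ≤ M) (hbd : ∀ j ≤ M, |P.eval (j : ℝ)| ≤ B)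
    {x : ℝ} (hx : x ∈ Set.Icc (0 : ℝ) M) : |P.eval x| ≤ 2 * B := by
  obtain ⟨z, hz, hmax⟩ := (isCompact_Icc (a := (0 : ℝ)) (b := M)).exists_isMaxOn
    ⟨x, hx⟩ (f := fun y => |P.eval y|) (by fun_prop)
  refine (hmax hx).trans ?_
  set S := |P.eval z| with hS
  change S ≤ 2 * B
  rcases (abs_nonneg (P.eval z)).eq_or_lt' with h0 | h0
  · rw [hS, h0]; positivity
  obtain ⟨j, hj, hjz⟩ : ∃ j ≤ M, |z - j| ≤ 1 / 2 := by
    have hr := abs_sub_round z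
    have h1 : 0 ≤ round z := by
      rw [round_eq]; exact Int.floor_nonneg.2 (by linarith [hz.1])
    refine ⟨(round z).toNat, ?_, ?_⟩
    · have : round z < (M : ℤ) + 1 := by
        rw [round_eq, Int.floor_lt]
        push_cast
        linarith [hz.2]
      omega
    · have : (((round z).toNat : ℕ) : ℝ) = ((round z : ℤ) : ℝ) := by
        exact_mod_cast Int.toNat_of_nonneg h1
      rwa [this]
  have hM' : (0 : ℝ) < M := by exact_mod_cast hM
  have hjM : (j : ℝ) ∈ Set.Icc (0 : ℝ) M := ⟨by positivity, by exact_mod_cast hj⟩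
  have h := abs_eval_sub_eval_le hP h0 hM' (fun y hy => hmax hy) hjM hz
  have hc : 4 * (n : ℝ) ^ 2 / (M - 0) ≤ 1 := by
    rw [sub_zero, div_le_one hM']
    exact_mod_cast hn
  have h2 : 4 * (n : ℝ) ^ 2 / (M - 0) * S * |z - j| ≤ 1 * S * (1 / 2) := by gcongr
  have h3 := abs_sub_abs_le_abs_sub (P.eval z) (P.eval (j : ℝ))
  have h4 := hbd j hj
  linarith

lemma abs_fwdDiff_iter_eval_le {n : ℕ} {L : ℝ} (hL : 0 < L) (m : ℕ) :
    ∀ {P : ℝ[X]} {B : ℝ}, P.natDegree ≤ n → 0 < B →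
      (∀ x ∈ Set.Icc (0 : ℝ) (L + m), |P.eval x| ≤ B) →
      |(fwdDiff (1 : ℝ))^[m] (fun x => P.eval x) 0| ≤ (4 * n ^ 2 / L) ^ m * B := by
  induction m with
  | zero =>
    intro P B _ _ hbd
    simpa using hbd 0 ⟨le_rfl, by positivity⟩
  | succ m ih =>
    intro P B hP hB hbd
    have hstep : fwdDiff (1 : ℝ) (fun x => P.eval x) = fun x => (P.comp (X + C 1) - P).eval x := by
      funext x
      simp [fwdDiff]
    rw [Function.iterate_succ_apply, hstep]
    have hdeg : (P.comp (X + C 1) - P).natDegree ≤ n := by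
      refine (natDegree_sub_le _ _).trans (max_le ?_ hP)
      rw [natDegree_comp, natDegree_X_add_C, mul_one]
      exact hP
    rcases Nat.eq_zero_or_pos n with rfl | hn
    · have hc : P.comp (X + C 1) - P = 0 := by
        rw [eq_C_of_natDegree_le_zero hP]
        simp
      have : (fwdDiff (1 : ℝ))^[m] (fun x => (0 : ℝ[X]).eval x) 0 = 0 := by
        simp only [eval_zero]
        have hz : fwdDiff (1 : ℝ) (fun _ : ℝ => (0 : ℝ)) = fun _ => 0 := by
          funext x; simp [fwdDiff]
        rw [Function.iterate_fixed hz]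
      rw [hc, this, abs_zero]
      positivity
    · refine (ih (B := 4 * n ^ 2 / L * B) hdeg (by positivity) ?_).trans (le_of_eq (by ring))
      intro x hx
      push_cast at hbd
      have h := abs_eval_sub_eval_le hP hB (a := 0) (b := L + (m + 1)) (by positivity) hbd
        (x := x) (y := x + 1) ⟨hx.1, by linarith [hx.2]⟩ ⟨by linarith [hx.1], by linarith [hx.2]⟩
      simp only [eval_sub, eval_comp, eval_add, eval_X, eval_C]
      refine h.trans ?_
      rw [add_sub_cancel_left, abs_one, mul_one]
      gcongr
      linarith [(Nat.cast_nonneg m : (0 : ℝ) ≤ m)]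

/-- Alternating binomial sums of a low-degree polynomial bounded at integers are small. -/
lemma abs_alternating_sum_eval_le {n M k : ℕ} {P : ℝ[X]} (hP : P.natDegree ≤ n) {B L : ℝ}
    (hB : 0 < B) (hM : 0 < M) (hn : 4 * n ^ 2 ≤ M) (hbd : ∀ j ≤ M, |P.eval (j : ℝ)| ≤ B)
    (hL : 0 < L) (hLM : L + k ≤ M) :
    |∑ j ∈ range (k + 1), (-1 : ℝ) ^ (k - j) * k.choose j * P.eval (j : ℝ)| ≤
      (4 * n ^ 2 / L) ^ k * (2 * B) := by
  have h := abs_fwdDiff_iter_eval_le hL k hP (B := 2 * B) (by positivity)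
    (fun x hx => abs_eval_le_of_abs_eval_natCast_le hP hB hM hn hbd ⟨hx.1, hx.2.trans hLM⟩)
  rw [fwdDiff_iter_eq_sum_shift] at h
  simpa using h

end UnivariateBounds

section Symmetrization

/-- The number of vectors of weight `t` whose support contains a given set. -/
lemma card_wt_eq_and_subset {N t : ℕ} (T : Finset (Fin N)) :
    ((univ.filter fun y : Fin N → Bool => wt y = t ∧ ∀ j ∈ T, y j = true).card : ℕ) *
      N.choose T.card = N.choose t * t.choose T.card := by
  have hcard : (univ.filter fun y : Fin N → Bool => wt y = t ∧ ∀ j ∈ T, y j = true).card =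
      (((univ : Finset (Fin N)).powersetCard t).filter fun A => T ⊆ A).card := by
    refine Finset.card_bij' (fun y _ => univ.filter fun j => y j = true)
      (fun A _ => fun j => decide (j ∈ A)) ?_ ?_ ?_ ?_
    · intro y hy
      simp only [mem_filter, mem_univ, true_and, mem_powersetCard, subset_univ] at hy ⊢
      exact ⟨hy.1, fun j hj => by simpa using hy.2 j hj⟩
    · intro A hA
      simp only [mem_filter, mem_univ, true_and, mem_powersetCard, subset_univ] at hA ⊢
      refine ⟨?_, fun j hj => by simpa using hA.2 hj⟩
      rw [← hA.1, wt]
      congr 1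
      ext j
      simp
    · intro y _
      funext j
      simp
    · intro A _
      ext j
      simp
  rw [hcard]
  by_cases hTt : T.card ≤ t
  · by_cases htN : t ≤ N
    · have : (((univ : Finset (Fin N)).powersetCard t).filter fun A => T ⊆ A).card =
          ((univ \ T).powersetCard (t - T.card)).card := by
        refine Finset.card_bij' (fun A _ => A \ T) (fun A _ => A ∪ T) ?_ ?_ ?_ ?_
        · intro A hA
          simp only [mem_filter, mem_powersetCard, subset_univ, true_and] at hA
          rw [mem_powersetCard]
          refine ⟨sdiff_subset_sdiff (subset_univ _) le_rfl, ?_⟩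
          rw [card_sdiff_of_subset hA.2, hA.1]
        · intro A hA
          rw [mem_powersetCard] at hA
          simp only [mem_filter, mem_powersetCard, subset_univ, true_and]
          refine ⟨?_, subset_union_right⟩
          rw [card_union_of_disjoint (disjoint_of_subset_left hA.1 sdiff_disjoint), hA.2]
          omega
        · intro A hA
          simp only [mem_filter] at hA
          exact sdiff_union_of_subset hA.2
        · intro A hA
          rw [mem_powersetCard] at hA
          exact union_sdiff_cancel_right (disjoint_of_subset_left hA.1 sdiff_disjoint)
      rw [this, card_powersetCard, card_sdiff_of_subset (subset_univ _), card_univ,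
        Fintype.card_fin, mul_comm, Nat.choose_mul hTt]
    · rw [Nat.choose_eq_zero_of_lt (by omega : N < t), powersetCard_eq_empty.2 (by simp; omega)]
      simp
  · rw [Nat.choose_eq_zero_of_lt (by omega : t < T.card), mul_zero]
    rw [Finset.card_eq_zero.2, zero_mul]
    refine filter_eq_empty_iff.2 fun A hA h => ?_
    have := card_le_card h
    rw [(mem_powersetCard.1 hA).2] at this
    omega

lemma card_wt_eq {N : ℕ} (t : ℕ) :
    (univ.filter fun y : Fin N → Bool => wt y = t).card = N.choose t := by
  simpa using card_wt_eq_and_subset (N := N) (t := t) ∅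

/-- `g` averages, over each weight class, to a polynomial of degree at most `d` in the weight. -/
def HasSymmDegree {N : ℕ} (d : ℕ) (g : (Fin N → Bool) → ℝ) : Prop :=
  ∃ P : Polynomial ℝ, P.natDegree ≤ d ∧
    ∀ t : ℕ, ∑ y ∈ univ.filter (fun y : Fin N → Bool => wt y = t), g y =
      N.choose t * P.eval (t : ℝ)

lemma HasSymmDegree.const_mul {N d : ℕ} {g : (Fin N → Bool) → ℝ} (hg : HasSymmDegree d g)
    (c : ℝ) : HasSymmDegree d fun y => c * g y := by
  obtain ⟨P, hP, h⟩ := hg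
  refine ⟨Polynomial.C c * P, (Polynomial.natDegree_C_mul_le _ _).trans hP, fun t => ?_⟩
  rw [← mul_sum, h, Polynomial.eval_mul, Polynomial.eval_C]
  ring

lemma HasSymmDegree.sum {N d : ℕ} {ι : Type*} (s : Finset ι) {g : ι → (Fin N → Bool) → ℝ}
    (hg : ∀ i ∈ s, HasSymmDegree d (g i)) : HasSymmDegree d fun y => ∑ i ∈ s, g i y := by
  choose! P hP h using hg
  refine ⟨∑ i ∈ s, P i, Polynomial.natDegree_sum_le_of_forall_le _ _ hP, fun t => ?_⟩
  rw [sum_comm, Polynomial.eval_finsetSum, mul_sum]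
  exact sum_congr rfl fun i hi => h i hi t

lemma hasSymmDegree_prod_indicator {N d : ℕ} (T : Finset (Fin N)) (hT : T.card ≤ d) :
    HasSymmDegree d fun y : Fin N → Bool => ∏ j ∈ T, if y j = true then (1 : ℝ) else 0 := by
  refine ⟨Polynomial.C ((T.card.factorial : ℝ) * N.choose T.card)⁻¹ * descPochhammer ℝ T.card,
    (Polynomial.natDegree_C_mul_le _ _).trans ?_, fun t => ?_⟩
  · rwa [descPochhammer_natDegree]
  · have hpos : (0 : ℝ) < N.choose T.card := by
      exact_mod_cast Nat.choose_pos (by simpa using card_le_univ T)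
    have hf : (0 : ℝ) < T.card.factorial := by exact_mod_cast Nat.factorial_pos _
    rw [Polynomial.eval_mul, Polynomial.eval_C, descPochhammer_eval_eq_descFactorial,
      Nat.descFactorial_eq_factorial_mul_choose]
    simp_rw [prod_ite_zero, prod_const_one]
    rw [← sum_filter, filter_filter, sum_const, nsmul_eq_mul, mul_one]
    have h := card_wt_eq_and_subset (t := t) T
    have h' : ((univ.filter fun y : Fin N → Bool => wt y = t ∧ ∀ j ∈ T, y j = true).card : ℝ) *
      N.choose T.card = N.choose t * t.choose T.card := by exact_mod_cast h
    push_cast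
    field_simp
    linarith

lemma hasSymmDegree_prod {N d : ℕ} (T : Finset (Fin N)) (hT : T.card ≤ d) (h : Fin N → Bool → ℝ) :
    HasSymmDegree d fun y : Fin N → Bool => ∏ j ∈ T, h j (y j) := by
  have e : ∀ y : Fin N → Bool, ∏ j ∈ T, h j (y j) =
      ∑ A ∈ T.powerset, (∏ j ∈ A, (h j true - h j false)) * (∏ j ∈ T \ A, h j false) *
        ∏ j ∈ A, if y j = true then (1 : ℝ) else 0 := by
    intro y
    have : ∀ j, h j (y j) = (h j true - h j false) * (if y j = true then (1 : ℝ) else 0) +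
        h j false := by
      intro j
      cases y j <;> simp
    rw [prod_congr rfl fun j _ => this j, prod_add]
    refine sum_congr rfl fun A _ => ?_
    rw [prod_mul_distrib]
    ring
  simp_rw [e]
  refine HasSymmDegree.sum _ fun A hA => HasSymmDegree.const_mul ?_ _
  exact hasSymmDegree_prod_indicator A ((card_le_card (mem_powerset.1 hA)).trans hT)

/-- Symmetrizing a multivariate polynomial within one block of variables. -/
lemma hasSymmDegree_eval_update {N R : ℕ} (p : MvPolynomial (Fin R × Fin N) ℝ)
    (x : Fin R → Fin N → Bool) (i : Fin R) :
    HasSymmDegree p.totalDegree fun y : Fin N → Bool =>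
      MvPolynomial.eval (fun ij => toSign (Function.update x i y ij.1 ij.2)) p := by
  simp_rw [MvPolynomial.eval_eq']
  refine HasSymmDegree.sum _ fun e he => HasSymmDegree.const_mul ?_ _
  have hprod : ∀ y : Fin N → Bool,
      ∏ ij : Fin R × Fin N, toSign (Function.update x i y ij.1 ij.2) ^ e ij =
        (∏ i' ∈ univ.erase i, ∏ j, toSign (x i' j) ^ e (i', j)) *
          ∏ j ∈ univ.filter (fun j => e (i, j) ≠ 0), toSign (y j) ^ e (i, j) := by
    intro y
    rw [Fintype.prod_prod_type, ← mul_prod_erase univ _ (mem_univ i), mul_comm]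
    congr 1
    · refine prod_congr rfl fun i' hi' => prod_congr rfl fun j _ => ?_
      rw [Function.update_of_ne (ne_of_mem_erase hi')]
    · rw [prod_filter]
      refine prod_congr rfl fun j _ => ?_
      by_cases hj : e (i, j) = 0 <;> simp [hj]
  simp_rw [hprod]
  refine HasSymmDegree.const_mul (hasSymmDegree_prod _ ?_ fun j b => toSign b ^ e (i, j)) _
  refine le_trans ?_ (MvPolynomial.le_totalDegree he)
  calc (univ.filter fun j => e (i, j) ≠ 0).card ≤ e.support.card := by
        refine card_le_card_of_injOn (fun j => (i, j)) ?_ ?_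
        · intro j hj
          simpa using hj
        · intro a _ b _ h
          simpa using h
    _ = ∑ _ij ∈ e.support, 1 := by simp
    _ ≤ e.sum fun _ m => m :=
        sum_le_sum fun a ha => Nat.one_le_iff_ne_zero.2 (Finsupp.mem_support_iff.1 ha)

end Symmetrization

section Hybrid

/-- Replacing, one coordinate at a time, the factors of a product distribution. -/
lemma abs_sum_prod_sub_sum_prod_le {X : Type*} [Fintype X] {K : X → Prop} {ν₀ ν₁ : X → ℝ}
    (h₀ : ∀ y, 0 ≤ ν₀ y) (h₁ : ∀ y, 0 ≤ ν₁ y) (hs₀ : ∑ y, ν₀ y = 1) (hs₁ : ∑ y, ν₁ y = 1)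
    (hK₀ : ∀ y, ¬ K y → ν₀ y = 0) (hK₁ : ∀ y, ¬ K y → ν₁ y = 0) {η : ℝ} (R : ℕ) :
    ∀ G : (Fin R → X) → ℝ,
      (∀ x, (∀ i, K (x i)) → ∀ i, |∑ y, (ν₁ y - ν₀ y) * G (Function.update x i y)| ≤ η) →
      |∑ x, (∏ i, ν₁ (x i)) * G x - ∑ x, (∏ i, ν₀ (x i)) * G x| ≤ R * η := by
  induction R with
  | zero =>
    intro G _
    simp
  | succ R ih =>
    intro G hG
    have split : ∀ ν : X → ℝ, ∑ x : Fin (R + 1) → X, (∏ i, ν (x i)) * G x =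
        ∑ y, ν y * ∑ x : Fin R → X, (∏ i, ν (x i)) * G (Fin.cons y x) := by
      intro ν
      rw [← (Fin.consEquiv fun _ => X).sum_comp, Fintype.sum_prod_type]
      refine sum_congr rfl fun y _ => ?_
      rw [mul_sum]
      refine sum_congr rfl fun x _ => ?_
      simp [Fin.consEquiv, Fin.prod_univ_succ, mul_assoc]
    have mass : ∀ ν : X → ℝ, ∑ y, ν y = 1 → ∑ x : Fin R → X, ∏ i, ν (x i) = 1 := by
      intro ν hν
      rw [← Fintype.piFinset_univ, ← prod_univ_sum]
      simp [hν]
    obtain ⟨y₀, hy₀⟩ : ∃ y, K y := by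
      by_contra! h
      rw [sum_congr rfl fun y _ => hK₀ y (h y)] at hs₀
      simp at hs₀
    have first : |∑ y, (ν₁ y - ν₀ y) * ∑ x : Fin R → X, (∏ i, ν₁ (x i)) * G (Fin.cons y x)|
        ≤ η := by
      have e : ∑ y, (ν₁ y - ν₀ y) * ∑ x : Fin R → X, (∏ i, ν₁ (x i)) * G (Fin.cons y x) =
          ∑ x : Fin R → X, (∏ i, ν₁ (x i)) * ∑ y, (ν₁ y - ν₀ y) * G (Fin.cons y x) := by
        simp_rw [mul_sum]
        rw [sum_comm]
        exact sum_congr rfl fun x _ => sum_congr rfl fun y _ => by ring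
      rw [e]
      calc _ ≤ ∑ x : Fin R → X, (∏ i, ν₁ (x i)) * η := by
            refine (abs_sum_le_sum_abs _ _).trans (sum_le_sum fun x _ => ?_)
            rw [abs_mul, abs_of_nonneg (prod_nonneg fun i _ => h₁ _)]
            by_cases hx : ∀ i, K (x i)
            · refine mul_le_mul_of_nonneg_left ?_ (prod_nonneg fun i _ => h₁ _)
              have := hG (Fin.cons y₀ x) (fun i => by
                refine Fin.cases ?_ (fun i => ?_) i
                · simpa using hy₀
                · simpa using hx i) 0
              simpa [Fin.update_cons_zero] using this
            · push Not at hx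
              obtain ⟨i, hi⟩ := hx
              rw [prod_eq_zero (mem_univ i) (hK₁ _ hi)]
              simp
        _ = η := by rw [← sum_mul, mass ν₁ hs₁, one_mul]
    have second : |∑ y, ν₀ y * (∑ x : Fin R → X, (∏ i, ν₁ (x i)) * G (Fin.cons y x) -
        ∑ x : Fin R → X, (∏ i, ν₀ (x i)) * G (Fin.cons y x))| ≤ R * η := by
      calc _ ≤ ∑ y, ν₀ y * (R * η) := by
            refine (abs_sum_le_sum_abs _ _).trans (sum_le_sum fun y _ => ?_)
            rw [abs_mul, abs_of_nonneg (h₀ y)]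
            by_cases hy : K y
            · refine mul_le_mul_of_nonneg_left (ih (fun x => G (Fin.cons y x)) ?_) (h₀ y)
              intro x hx i
              have := hG (Fin.cons y x) (fun i => by
                refine Fin.cases ?_ (fun i => ?_) i
                · simpa using hy
                · simpa using hx i) i.succ
              simpa [Fin.cons_update] using this
            · simp [hK₀ y hy]
        _ = R * η := by rw [← sum_mul, hs₀, one_mul]
    rw [split ν₁, split ν₀]
    have e : ∑ y, ν₁ y * ∑ x : Fin R → X, (∏ i, ν₁ (x i)) * G (Fin.cons y x) -
        ∑ y, ν₀ y * ∑ x : Fin R → X, (∏ i, ν₀ (x i)) * G (Fin.cons y x) =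
        ∑ y, (ν₁ y - ν₀ y) * ∑ x : Fin R → X, (∏ i, ν₁ (x i)) * G (Fin.cons y x) +
        ∑ y, ν₀ y * (∑ x : Fin R → X, (∏ i, ν₁ (x i)) * G (Fin.cons y x) -
        ∑ x : Fin R → X, (∏ i, ν₀ (x i)) * G (Fin.cons y x)) := by
      rw [← sum_sub_distrib, ← sum_add_distrib]
      exact sum_congr rfl fun y _ => by ring
    rw [e]
    refine (abs_add_le _ _).trans ?_
    push_cast
    linarith

end Hybrid

section BlockDistribution

/-- A perturbed binomial distribution on `{0, …, k}`; for `ε = ±1` it lives on one parity class. -/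
noncomputable def parityBinom (k : ℕ) (ε : ℝ) (j : ℕ) : ℝ :=
  k.choose j * (1 + ε * (-1) ^ (k - j)) / 2 ^ k

/-- The distribution on `{−1,1}^N` with weight distributed as `parityBinom k ε` and uniform
given its weight. -/
noncomputable def blockDist (N k : ℕ) (ε : ℝ) (y : Fin N → Bool) : ℝ :=
  parityBinom k ε (wt y) / N.choose (wt y)

lemma wt_le {N : ℕ} (y : Fin N → Bool) : wt y ≤ N := by
  simpa [wt] using card_le_univ (univ.filter fun i => y i = true)

lemma sum_blockDist_mul {N k : ℕ} (hkN : k ≤ N) (ε : ℝ) {g : (Fin N → Bool) → ℝ} {h : ℕ → ℝ}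
    (hg : ∀ t, ∑ y ∈ univ.filter (fun y : Fin N → Bool => wt y = t), g y = N.choose t * h t) :
    ∑ y, blockDist N k ε y * g y = ∑ j ∈ range (k + 1), parityBinom k ε j * h j := by
  rw [← sum_fiberwise_of_maps_to (s := univ) (t := range (N + 1)) (g := wt)
    (fun y _ => mem_range.2 (Nat.lt_succ_of_le (wt_le y)))]
  have inner : ∀ t ∈ range (N + 1),
      ∑ y ∈ univ.filter (fun y : Fin N → Bool => wt y = t), blockDist N k ε y * g y =
        parityBinom k ε t * h t := by
    intro t ht
    have hpos : (N.choose t : ℝ) ≠ 0 := by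
      exact_mod_cast (Nat.choose_pos (Nat.lt_succ_iff.1 (mem_range.1 ht))).ne'
    have : ∀ y ∈ univ.filter (fun y : Fin N → Bool => wt y = t),
        blockDist N k ε y * g y = parityBinom k ε t / N.choose t * g y := by
      intro y hy
      rw [blockDist, (mem_filter.1 hy).2]
    rw [sum_congr rfl this, ← mul_sum, hg]
    field_simp
  rw [sum_congr rfl inner]
  refine (sum_subset (range_subset_range.2 (by omega)) fun j _ hj => ?_).symm
  rw [parityBinom, Nat.choose_eq_zero_of_lt (by simpa using hj)]
  simp

lemma sum_parityBinom {k : ℕ} (hk : k ≠ 0) (ε : ℝ) :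
    ∑ j ∈ range (k + 1), parityBinom k ε j = 1 := by
  have h1 : ∑ j ∈ range (k + 1), (k.choose j : ℝ) = 2 ^ k := by
    exact_mod_cast Nat.sum_range_choose k
  have h2 : ∑ j ∈ range (k + 1), (-1 : ℝ) ^ (k - j) * k.choose j = 0 := by
    have := add_pow (1 : ℝ) (-1) k
    simp only [one_pow, one_mul, add_neg_cancel, zero_pow hk] at this
    exact this.symm
  calc _ = (∑ j ∈ range (k + 1), (k.choose j : ℝ) +
        ε * ∑ j ∈ range (k + 1), (-1 : ℝ) ^ (k - j) * k.choose j) / 2 ^ k := by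
        rw [mul_sum, ← sum_add_distrib, sum_div]
        exact sum_congr rfl fun j _ => by rw [parityBinom]; ring
    _ = 1 := by rw [h1, h2, mul_zero, add_zero, div_self (by positivity)]

lemma sum_blockDist {N k : ℕ} (hk : k ≠ 0) (hkN : k ≤ N) (ε : ℝ) :
    ∑ y, blockDist N k ε y = 1 := by
  have := sum_blockDist_mul hkN ε (g := fun _ => 1) (h := fun _ => 1)
    (fun t => by simp [card_wt_eq])
  simpa [sum_parityBinom hk] using this

lemma blockDist_nonneg {N k : ℕ} {ε : ℝ} (hε : |ε| ≤ 1) (y : Fin N → Bool) :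
    0 ≤ blockDist N k ε y := by
  rw [blockDist, parityBinom]
  have : 0 ≤ 1 + ε * (-1) ^ (k - wt y) := by
    have := neg_abs_le (ε * (-1) ^ (k - wt y))
    rw [abs_mul, abs_pow, abs_neg, abs_one, one_pow, mul_one] at this
    linarith
  positivity

lemma blockDist_eq_zero {N k : ℕ} {ε : ℝ} {y : Fin N → Bool} (hy : ¬ wt y ≤ k) :
    blockDist N k ε y = 0 := by
  rw [blockDist, parityBinom, Nat.choose_eq_zero_of_lt (by omega)]
  simp

lemma blockDist_neg_one_eq_zero {N k : ℕ} {y : Fin N → Bool} (hy : ¬ wt y < k) :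
    blockDist N k (-1) y = 0 := by
  rcases (not_lt.1 hy).eq_or_lt with h | h
  · simp [blockDist, parityBinom, ← h]
  · exact blockDist_eq_zero (by omega)

lemma sum_blockDist_mul_exp {N k : ℕ} (hk : k ≠ 0) (hkN : k ≤ N) :
    ∑ y : Fin N → Bool, blockDist N k 1 y * (if THR N k y = true then Real.exp (-1) else 1) ≤
      Real.exp (-(1 / 2 ^ k)) := by
  rw [sum_blockDist_mul hkN 1 (h := fun t => if k ≤ t then Real.exp (-1) else 1)]
  · have e : ∀ j ∈ range (k + 1), parityBinom k 1 j * (if k ≤ j then Real.exp (-1) else 1) =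
        parityBinom k 1 j - if k = j then (1 - Real.exp (-1)) * parityBinom k 1 k else 0 := by
      intro j hj
      have : j ≤ k := Nat.lt_succ_iff.1 (mem_range.1 hj)
      by_cases h : k = j
      · subst h; simp; ring
      · rw [if_neg h, if_neg (by omega)]; ring
    rw [sum_congr rfl e, sum_sub_distrib, sum_parityBinom hk, sum_ite_eq, if_pos (by simp)]
    have hq : parityBinom k 1 k = 2 * (1 / 2 ^ k) := by
      simp [parityBinom]; ring
    have hexp : Real.exp (-1) ≤ 1 / 2 := by
      rw [Real.exp_neg, one_div]
      exact inv_anti₀ two_pos (by linarith [Real.add_one_le_exp (1 : ℝ)])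
    have := Real.add_one_le_exp (-(1 / 2 ^ k : ℝ))
    have hp : (0 : ℝ) < 1 / 2 ^ k := by positivity
    rw [hq]
    nlinarith
  · intro t
    rw [sum_congr rfl (g := fun _ => if k ≤ t then Real.exp (-1) else 1)]
    · simp [card_wt_eq]
    · intro y hy
      simp [THR, (mem_filter.1 hy).2]

end BlockDistribution

section MainProof

lemma wt2_eq_sum {N R : ℕ} (x : Fin R → Fin N → Bool) : wt2 x = ∑ i, wt (x i) := by
  simp only [wt2, wt, card_filter]
  rw [Fintype.sum_prod_type]

/-- Exponential Markov bound: under the high distribution, a function that is at most `-1/3`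
whenever many blocks reach the threshold, and at most `5/3` always, has negative mean. -/
lemma sum_blockDist_one_le {N R k : ℕ} (hk : k ≠ 0) (hkN : k ≤ N) {γ : ℝ}
    {G : (Fin R → Fin N → Bool) → ℝ}
    (hbd : ∀ x, (∀ i, wt (x i) ≤ k) → G x ≤ 5 / 3)
    (hgood : ∀ x, (∀ i, wt (x i) ≤ k) →
      γ * R ≤ ((univ.filter fun i => THR N k (x i) = true).card : ℝ) → G x ≤ -(1 / 3)) :
    ∑ x : Fin R → Fin N → Bool, (∏ i, blockDist N k 1 (x i)) * G x ≤
      -(1 / 3) + 2 * Real.exp ((γ - 1 / 2 ^ k) * R) := by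
  have hν : ∀ y : Fin N → Bool, 0 ≤ blockDist N k 1 y := blockDist_nonneg (by simp)
  calc _ ≤ ∑ x : Fin R → Fin N → Bool, (∏ i, blockDist N k 1 (x i)) *
        (-(1 / 3) + 2 * Real.exp (γ * R) *
          ∏ i, if THR N k (x i) = true then Real.exp (-1) else 1) := by
        refine sum_le_sum fun x _ => ?_
        by_cases hx : ∀ i, wt (x i) ≤ k
        · refine mul_le_mul_of_nonneg_left ?_ (prod_nonneg fun i _ => hν _)
          rw [prod_ite, prod_const, prod_const_one, mul_one, ← Real.exp_nat_mul, mul_assoc,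
            ← Real.exp_add]
          by_cases hg : γ * R ≤ ((univ.filter fun i => THR N k (x i) = true).card : ℝ)
          · have := hgood x hx hg
            have := Real.exp_pos (γ * R +
              ((univ.filter fun i => THR N k (x i) = true).card : ℝ) * -1)
            linarith
          · have := hbd x hx
            have := Real.one_le_exp (x := γ * R +
              ((univ.filter fun i => THR N k (x i) = true).card : ℝ) * -1) (by linarith)
            linarith
        · push Not at hx
          obtain ⟨i, hi⟩ := hx
          rw [prod_eq_zero (mem_univ i) (blockDist_eq_zero (not_le.2 hi))]
          simp
    _ = -(1 / 3) * (∑ y : Fin N → Bool, blockDist N k 1 y) ^ R + 2 * Real.exp (γ * R) *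
        (∑ y : Fin N → Bool, blockDist N k 1 y *
          (if THR N k y = true then Real.exp (-1) else 1)) ^ R := by
        have hpow : ∀ φ : (Fin N → Bool) → ℝ,
            (∑ y, φ y) ^ R = ∑ x : Fin R → Fin N → Bool, ∏ i, φ (x i) := by
          intro φ
          have := prod_univ_sum (fun _ : Fin R => univ) fun _ => φ
          simpa using this
        rw [hpow, hpow, mul_sum, mul_sum, ← sum_add_distrib]
        refine sum_congr rfl fun x _ => ?_
        rw [prod_mul_distrib]
        ring
    _ ≤ -(1 / 3) * 1 ^ R + 2 * Real.exp (γ * R) * Real.exp (-(1 / 2 ^ k)) ^ R := by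
        rw [sum_blockDist hk hkN]
        have h0 : 0 ≤ ∑ y : Fin N → Bool, blockDist N k 1 y *
            (if THR N k y = true then Real.exp (-1) else 1) :=
          sum_nonneg fun y _ => mul_nonneg (hν y) (by split_ifs <;> positivity)
        gcongr
        exact sum_blockDist_mul_exp hk hkN
    _ = _ := by
        rw [one_pow, mul_one, ← Real.exp_nat_mul, mul_assoc, ← Real.exp_add]
        congr 3
        ring

/-- Swapping the distribution of a single block changes the mean of a low-degree polynomial,
bounded on inputs of weight at most `N`, only slightly. -/
lemma abs_sum_blockDist_sub_mul_le {N R k : ℕ} (hk : k ≠ 0) (p : MvPolynomial (Fin R × Fin N) ℝ)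
    (hbd : ∀ x : Fin R → Fin N → Bool, wt2 x ≤ N →
      |MvPolynomial.eval (fun ij => toSign (x ij.1 ij.2)) p| ≤ 5 / 3)
    (hN : 0 < N) (hkR : 4 * (k * (R + 1)) ≤ 2 * N) (hd : 8 * p.totalDegree ^ 2 ≤ N)
    (x : Fin R → Fin N → Bool) (hx : ∀ i, wt (x i) ≤ k) (i : Fin R) :
    |∑ y, (blockDist N k 1 y - blockDist N k (-1) y) *
      MvPolynomial.eval (fun ij => toSign (Function.update x i y ij.1 ij.2)) p| ≤
      (8 * p.totalDegree ^ 2 / N) ^ k * (10 / 3) := by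
  obtain ⟨P, hP, hPt⟩ := hasSymmDegree_eval_update p x i
  have hkN : k ≤ N := by nlinarith [Nat.zero_le (k * R)]
  have hkRN : k * R ≤ N := by nlinarith [Nat.zero_le k]
  have hPbd : ∀ j ≤ N - k * R, |P.eval (j : ℝ)| ≤ 5 / 3 := by
    intro j hj
    have hjN : j ≤ N := by omega
    have hpos : (0 : ℝ) < N.choose j := by exact_mod_cast Nat.choose_pos hjN
    have h := hPt j
    have hsum : |∑ y ∈ univ.filter (fun y : Fin N → Bool => wt y = j),
        MvPolynomial.eval (fun ij => toSign (Function.update x i y ij.1 ij.2)) p| ≤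
        N.choose j * (5 / 3) := by
      refine (abs_sum_le_sum_abs _ _).trans ?_
      rw [← card_wt_eq, ← nsmul_eq_mul]
      refine sum_le_card_nsmul _ _ _ fun y hy => hbd _ ?_
      rw [wt2_eq_sum, ← add_sum_erase _ _ (mem_univ i), Function.update_self,
        (mem_filter.1 hy).2]
      have : ∑ i' ∈ univ.erase i, wt (Function.update x i y i') ≤ ∑ _i' : Fin R, k := by
        calc _ ≤ ∑ i' ∈ univ.erase i, k := sum_le_sum fun i' hi' => by
              rw [Function.update_of_ne (ne_of_mem_erase hi')]
              exact hx i'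
          _ ≤ _ := sum_le_sum_of_subset (subset_univ _)
      have hc : ∑ _i' : Fin R, k = k * R := by simp [mul_comm]
      omega
    rw [h, abs_mul, abs_of_pos hpos] at hsum
    exact le_of_mul_le_mul_left hsum hpos
  have hcast : ((N - k * R : ℕ) : ℝ) = N - k * R := by
    rw [Nat.cast_sub hkRN]; push_cast; ring
  have hkR' : 4 * ((k : ℝ) * (R + 1)) ≤ 2 * N := by exact_mod_cast hkR
  have hN' : (0 : ℝ) < N := by exact_mod_cast hN
  have hk0 : (0 : ℝ) ≤ k := Nat.cast_nonneg k
  have h2 : 2 * (N - k * R) ≥ N := by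
    have : 4 * (k * R) ≤ 2 * N := le_trans (by nlinarith) hkR
    omega
  have halt := abs_alternating_sum_eval_le (k := k) hP (by norm_num : (0 : ℝ) < 5 / 3)
    (M := N - k * R) (L := N / 2) (by omega) (by omega) hPbd (by positivity)
    (by rw [hcast]; linarith)
  have e : ∑ y, (blockDist N k 1 y - blockDist N k (-1) y) *
      MvPolynomial.eval (fun ij => toSign (Function.update x i y ij.1 ij.2)) p =
      (2 / 2 ^ k) * ∑ j ∈ range (k + 1), (-1 : ℝ) ^ (k - j) * k.choose j * P.eval (j : ℝ) := by
    simp_rw [sub_mul]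
    rw [sum_sub_distrib, sum_blockDist_mul hkN 1 hPt, sum_blockDist_mul hkN (-1) hPt,
      ← sum_sub_distrib, mul_sum]
    refine sum_congr rfl fun j _ => ?_
    rw [parityBinom, parityBinom]
    ring
  have hle : (2 : ℝ) / 2 ^ k ≤ 1 := by
    rw [div_le_one (by positivity)]
    simpa using pow_le_pow_right₀ (one_le_two : (1 : ℝ) ≤ 2) (Nat.one_le_iff_ne_zero.2 hk)
  rw [e, abs_mul, abs_of_pos (by positivity)]
  refine (mul_le_of_le_one_left (abs_nonneg _) hle).trans (halt.trans (le_of_eq ?_))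
  have h8 : 4 * (p.totalDegree : ℝ) ^ 2 / (N / 2) = 8 * p.totalDegree ^ 2 / N := by ring
  rw [h8]
  norm_num

/-- A low-degree polynomial bounded on inputs of weight at most `N` has similar means under the
low and the high product distributions. -/
lemma abs_sum_blockDist_one_sub_neg_one_le {N R k : ℕ} (hk : k ≠ 0)
    (p : MvPolynomial (Fin R × Fin N) ℝ)
    (hbd : ∀ x : Fin R → Fin N → Bool, wt2 x ≤ N →
      |MvPolynomial.eval (fun ij => toSign (x ij.1 ij.2)) p| ≤ 5 / 3)
    (hN : 0 < N) (hkR : 4 * (k * (R + 1)) ≤ 2 * N) (hd : 8 * p.totalDegree ^ 2 ≤ N) :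
    |∑ x : Fin R → Fin N → Bool, (∏ i, blockDist N k 1 (x i)) *
        MvPolynomial.eval (fun ij => toSign (x ij.1 ij.2)) p -
      ∑ x : Fin R → Fin N → Bool, (∏ i, blockDist N k (-1) (x i)) *
        MvPolynomial.eval (fun ij => toSign (x ij.1 ij.2)) p| ≤
      R * ((8 * p.totalDegree ^ 2 / N) ^ k * (10 / 3)) := by
  have hkN : k ≤ N := by nlinarith [Nat.zero_le (k * R)]
  have key := fun (x : Fin R → Fin N → Bool) (hx : ∀ i, wt (x i) ≤ k) (i : Fin R) =>
    abs_sum_blockDist_sub_mul_le hk p hbd hN hkR hd x hx i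
  generalize (8 * (p.totalDegree : ℝ) ^ 2 / N) ^ k * (10 / 3) = η at key ⊢
  have hyb := abs_sum_prod_sub_sum_prod_le (K := fun y : Fin N → Bool => wt y ≤ k)
    (blockDist_nonneg (k := k) (ε := -1) (by simp)) (blockDist_nonneg (k := k) (ε := 1) (by simp))
    (sum_blockDist hk hkN _) (sum_blockDist hk hkN _)
    (fun y hy => blockDist_eq_zero hy) (fun y hy => blockDist_eq_zero hy) R
    (fun x => MvPolynomial.eval (fun ij => toSign (x ij.1 ij.2)) p) (η := η)
  exact hyb key

end MainProof

theorem stmt13 (k : ℕ) (hk : 3 ≤ k) (γ : ℝ) (hγ0 : 0 < γ) (hγ : γ < 1 / 4 ^ (k - 1)) :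
    ∃ c : ℝ, 0 < c ∧ ∃ R₀ : ℕ, ∀ R : ℕ, R₀ ≤ R →
      ∀ N : ℕ, N = ⌈(20 : ℝ) * (2 * (k : ℝ)) ^ ((k : ℝ) / 2)⌉₊ * R →
      ∀ p : MvPolynomial (Fin R × Fin N) ℝ,
        -- p approximates f to within 2/3 on the domain restricted to weight ≤ N
        (∀ x : Fin R → Fin N → Bool, inDom γ N R k x → wt2 x ≤ N →
          |MvPolynomial.eval (fun ij => toSign (x ij.1 ij.2)) p - fval N R k x| < 2 / 3) →
        -- p is bounded by 5/3 outside the domain, on inputs of weight ≤ N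
        (∀ x : Fin R → Fin N → Bool, ¬ inDom γ N R k x → wt2 x ≤ N →
          |MvPolynomial.eval (fun ij => toSign (x ij.1 ij.2)) p| < 5 / 3) →
        c * Real.sqrt ((N : ℝ) ^ ((1 : ℝ) - 1 / (k : ℝ))) / (Real.log N) ^ 2 ≤
          (p.totalDegree : ℝ) := by
  refine ⟨1 / 10, by norm_num, 20 * 2 ^ k, fun R hR N hN p happ hout => ?_⟩
  have hk0 : k ≠ 0 := by omega
  have hR1 : 1 ≤ R := le_trans (by have := Nat.one_le_two_pow (n := k); omega) hR
  have hRr : (1 : ℝ) ≤ R := by exact_mod_cast hR1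
  have hkr : (3 : ℝ) ≤ k := by exact_mod_cast hk
  have hNR : 40 * k * R ≤ N := by
    have h1 : (2 * k : ℝ) ^ (1 : ℝ) ≤ (2 * k : ℝ) ^ ((k : ℝ) / 2) :=
      Real.rpow_le_rpow_of_exponent_le (by linarith) (by linarith)
    rw [Real.rpow_one] at h1
    have h2 : ((40 * k : ℕ) : ℝ) ≤ (⌈(20 : ℝ) * (2 * (k : ℝ)) ^ ((k : ℝ) / 2)⌉₊ : ℝ) := by
      refine le_trans ?_ (Nat.le_ceil _)
      push_cast
      linarith
    rw [hN]
    exact Nat.mul_le_mul_right _ (by exact_mod_cast h2)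
  have hkR1 : k * 1 ≤ k * R := Nat.mul_le_mul_left k hR1
  have hR3 : 3 * R ≤ k * R := Nat.mul_le_mul_right R hk
  have hkN : k ≤ N := by nlinarith
  have hRN : R ≤ N := by nlinarith
  have hN0 : 0 < N := by omega
  have hNr : (1 : ℝ) ≤ N := by exact_mod_cast hN0
  have hbd : ∀ x : Fin R → Fin N → Bool, wt2 x ≤ N →
      |MvPolynomial.eval (fun ij => toSign (x ij.1 ij.2)) p| ≤ 5 / 3 := by
    intro x hx
    by_cases hD : inDom γ N R k x
    · have h := happ x hD hx
      have hf : |fval N R k x| = 1 := by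
        rw [fval]; split_ifs <;> simp
      have := abs_sub_abs_le_abs_sub
        (MvPolynomial.eval (fun ij => toSign (x ij.1 ij.2)) p) (fval N R k x)
      linarith
    · exact (hout x hD hx).le
  have hwt : ∀ x : Fin R → Fin N → Bool, (∀ i, wt (x i) ≤ k) → wt2 x ≤ N := by
    intro x hx
    rw [wt2_eq_sum]
    calc ∑ i, wt (x i) ≤ ∑ _i : Fin R, k := sum_le_sum fun i _ => hx i
      _ = k * R := by simp [mul_comm]
      _ ≤ N := by nlinarith
  by_contra! hlt
  set d := p.totalDegree with hd
  set S := (N : ℝ) ^ ((1 : ℝ) - 1 / (k : ℝ)) with hS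
  have hS0 : 0 ≤ S := by positivity
  have hd2 : (d : ℝ) ^ 2 ≤ S / 100 := by
    have hlog : 1 ≤ Real.log N := by
      rw [Real.le_log_iff_exp_le (by linarith)]
      have h3 : (120 : ℝ) ≤ N := by
        have : 120 ≤ N := by nlinarith
        exact_mod_cast this
      linarith [Real.exp_one_lt_d9]
    have h1 : 1 / 10 * Real.sqrt S / Real.log N ^ 2 ≤ 1 / 10 * Real.sqrt S :=
      div_le_self (by positivity) (one_le_pow₀ hlog)
    have h2 : (d : ℝ) ≤ 1 / 10 * Real.sqrt S := by linarith
    calc (d : ℝ) ^ 2 ≤ (1 / 10 * Real.sqrt S) ^ 2 := by gcongr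
      _ = S / 100 := by rw [mul_pow, Real.sq_sqrt hS0]; ring
  have hSN : S ≤ N := by
    calc S ≤ (N : ℝ) ^ (1 : ℝ) :=
          Real.rpow_le_rpow_of_exponent_le hNr (by linarith [show 0 ≤ 1 / (k : ℝ) by positivity])
      _ = N := Real.rpow_one _
  have hSk : (S / N) ^ k = 1 / N := by
    have hN1 : (0 : ℝ) < N := by linarith
    have : S / N = (N : ℝ) ^ (-(1 / (k : ℝ))) := by
      rw [hS, div_eq_iff hN1.ne']
      nth_rewrite 3 [← Real.rpow_one (N : ℝ)]
      rw [← Real.rpow_add hN1]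
      congr 1
      ring
    rw [this, ← Real.rpow_natCast, ← Real.rpow_mul hN1.le]
    have : -(1 / (k : ℝ)) * k = -1 := by field_simp
    rw [this, Real.rpow_neg_one, one_div]
  have hkR : 4 * (k * (R + 1)) ≤ 2 * N := by nlinarith
  have hdN : 8 * d ^ 2 ≤ N := by
    have : 8 * (d : ℝ) ^ 2 ≤ N := by linarith
    exact_mod_cast this
  have hswap := abs_sum_blockDist_one_sub_neg_one_le hk0 p hbd hN0 hkR hdN
  have hlow : 1 / 3 ≤ ∑ x : Fin R → Fin N → Bool, (∏ i, blockDist N k (-1) (x i)) *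
      MvPolynomial.eval (fun ij => toSign (x ij.1 ij.2)) p := by
    have hmass : ∑ x : Fin R → Fin N → Bool, ∏ i, blockDist N k (-1) (x i) = 1 := by
      have := prod_univ_sum (fun _ : Fin R => univ) fun _ => blockDist N k (-1)
      simpa [sum_blockDist hk0 hkN] using this.symm
    calc (1 : ℝ) / 3 = ∑ x : Fin R → Fin N → Bool,
          (∏ i, blockDist N k (-1) (x i)) * (1 / 3) := by rw [← sum_mul, hmass, one_mul]
      _ ≤ _ := by
        refine sum_le_sum fun x _ => ?_
        by_cases hx : ∀ i, wt (x i) < k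
        · refine mul_le_mul_of_nonneg_left ?_
            (prod_nonneg fun i _ => blockDist_nonneg (by simp) _)
          have hT : ∀ i, THR N k (x i) = false := fun i => by simpa [THR] using hx i
          have h := happ x (Or.inl hT) (hwt x fun i => (hx i).le)
          rw [fval, if_pos hT, abs_lt] at h
          linarith
        · push Not at hx
          obtain ⟨i, hi⟩ := hx
          rw [prod_eq_zero (mem_univ i) (blockDist_neg_one_eq_zero (not_lt.2 hi))]
          simp
  have hupper : ∀ x : Fin R → Fin N → Bool, (∀ i, wt (x i) ≤ k) →
      MvPolynomial.eval (fun ij => toSign (x ij.1 ij.2)) p ≤ 5 / 3 :=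
    fun x hx => (le_abs_self _).trans (hbd x (hwt x hx))
  have hgood : ∀ x : Fin R → Fin N → Bool, (∀ i, wt (x i) ≤ k) →
      γ * R ≤ ((univ.filter fun i => THR N k (x i) = true).card : ℝ) →
      MvPolynomial.eval (fun ij => toSign (x ij.1 ij.2)) p ≤ -(1 / 3) := by
    intro x hx hcard
    have h := happ x (Or.inr hcard) (hwt x hx)
    have hT : ¬ ∀ i, THR N k (x i) = false := by
      intro hT
      have : (0 : ℝ) < γ * R := by positivity
      simp [hT] at hcard
      linarith
    rw [fval, if_neg hT, abs_lt] at h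
    linarith
  have hmean := sum_blockDist_one_le (N := N) (R := R) hk0 hkN (γ := γ)
    (G := fun x => MvPolynomial.eval (fun ij => toSign (x ij.1 ij.2)) p)
  have hhigh := hmean hupper hgood
  have hexp : Real.exp ((γ - 1 / 2 ^ k) * R) ≤ 1 / 6 := by
    have hγ' : γ ≤ 1 / 2 * (1 / 2 ^ k) := by
      refine hγ.le.trans ?_
      obtain ⟨m, rfl⟩ : ∃ m, k = m + 3 := ⟨k - 3, by omega⟩
      have h4 : (4 : ℝ) ^ (m + 3 - 1) = (2 ^ m) * 2 ^ m * 16 := by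
        rw [show m + 3 - 1 = m + 2 by omega, pow_add, ← mul_pow]; norm_num
      have h1 : (1 : ℝ) ≤ 2 ^ m := one_le_pow₀ one_le_two
      rw [h4, pow_add, ← one_div_mul_one_div_rev, ← one_div_mul_one_div_rev]
      have h2 : 1 / (2 : ℝ) ^ m ≤ 1 := by rw [div_le_one (by positivity)]; exact h1
      have h3 : 0 < 1 / (2 : ℝ) ^ m := by positivity
      rw [← one_div_mul_one_div_rev]
      nlinarith
    have hR' : (20 : ℝ) * 2 ^ k ≤ R := by exact_mod_cast hR
    have hle : (γ - 1 / 2 ^ k) * R ≤ -10 := by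
      have h2k : (0 : ℝ) < 1 / 2 ^ k := by positivity
      have h1 : 1 / 2 ^ k * (20 * 2 ^ k : ℝ) = 20 := by field_simp
      have h2 : 1 / 2 ^ k * (20 * 2 ^ k : ℝ) ≤ 1 / 2 ^ k * R := by gcongr
      nlinarith
    calc Real.exp ((γ - 1 / 2 ^ k) * R) ≤ Real.exp (-10) := Real.exp_le_exp.2 hle
      _ = (Real.exp 10)⁻¹ := Real.exp_neg _
      _ ≤ 6⁻¹ := inv_anti₀ (by norm_num) (by linarith [Real.add_one_le_exp (10 : ℝ)])
      _ = 1 / 6 := by norm_num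
  have hη : (R : ℝ) * ((8 * (d : ℝ) ^ 2 / N) ^ k * (10 / 3)) < 1 / 3 := by
    have h1 : 8 * (d : ℝ) ^ 2 / N ≤ 8 / 100 * (S / N) := by
      rw [← mul_div_assoc]
      exact div_le_div_of_nonneg_right (by linarith) (by linarith)
    have h2 : (8 * (d : ℝ) ^ 2 / N) ^ k ≤ 8 / 100 * (1 / N) := by
      calc (8 * (d : ℝ) ^ 2 / N) ^ k ≤ (8 / 100 * (S / N)) ^ k := by gcongr
        _ = (8 / 100) ^ k * (1 / N) := by rw [mul_pow, hSk]
        _ ≤ 8 / 100 * (1 / N) := by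
          gcongr
          exact pow_le_of_le_one (by norm_num) (by norm_num) hk0
    have h3 : (R : ℝ) * (1 / N) ≤ 1 := by
      rw [mul_one_div, div_le_one (by linarith)]
      exact_mod_cast hRN
    calc (R : ℝ) * ((8 * (d : ℝ) ^ 2 / N) ^ k * (10 / 3)) ≤
          R * (8 / 100 * (1 / N) * (10 / 3)) := by gcongr
      _ < 1 / 3 := by linarith
  have := neg_abs_le (∑ x : Fin R → Fin N → Bool, (∏ i, blockDist N k 1 (x i)) *
      MvPolynomial.eval (fun ij => toSign (x ij.1 ij.2)) p -
    ∑ x : Fin R → Fin N → Bool, (∏ i, blockDist N k (-1) (x i)) *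
      MvPolynomial.eval (fun ij => toSign (x ij.1 ij.2)) p)
  linarith
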